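/- The mountain M(P) := {(x,s) ∈ ℝ^{n+1} : x ∈ P, 0 ≤ s ≤ d_P(x)} satisfies M(P) = {(x,s) ∈ ℝ^{n+1} : ⟨a_i, x⟩ − s ≥ b_i for i = 1,…,m, and s ≥ 0}; hence M(P) is a rational polytope whose horizontal slice at height s₀ is P^(s₀) × {s₀}. Moreover, μ(P)^{-1} equals the maximum of the last coordinates of the vertices of M(P), and if the normal fan N(P) is Q-Gorenstein, then τ(P)^{-1} equals the minimum of the positive last coordinates of the vertices of M(P). -/

import Mathlib

open scoped BigOperators Pointwise

noncomputable section

/-- Pairing `⟨a, x⟩ = ∑ aⱼ xⱼ` of an integer linear functional with a real point. -/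
def ipair {n : ℕ} (a : Fin n → ℤ) (x : Fin n → ℝ) : ℝ := ∑ j, (a j : ℝ) * x j

/-- An integer vector is primitive if it is nonzero and not a nontrivial integer
multiple of another integer vector. -/
def IsPrimitive {n : ℕ} (a : Fin n → ℤ) : Prop :=
  a ≠ 0 ∧ ∀ (k : ℤ) (b : Fin n → ℤ), a = k • b → IsUnit k

/-- The set of integer (lattice) points of `ℝⁿ`. -/
def IntPts (n : ℕ) : Set (Fin n → ℝ) := Set.range (fun z : Fin n → ℤ => fun j => (z j : ℝ))

/-- The dimension of a subset of `ℝⁿ` (the dimension of its affine hull). -/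
def setDim {n : ℕ} (S : Set (Fin n → ℝ)) : ℕ := Module.finrank ℝ (vectorSpan ℝ S)

/-- An irredundant facet description `P = {x : A x ≥ b}` of an `n`-dimensional
rational polytope: the rows `aᵢ` of `A` are primitive integer vectors, the right hand
sides are rational, `P` is bounded and `n`-dimensional, every inequality defines a facet
(a face of dimension `n-1`), and no inequality is repeated. -/
structure PolyDesc (n m : ℕ) : Type where
  hm : 0 < m
  A : Fin m → Fin n → ℤ
  b : Fin m → ℚ
  prim : ∀ i, IsPrimitive (A i)
  bounded : Bornology.IsBounded {x : Fin n → ℝ | ∀ i, (b i : ℝ) ≤ ipair (A i) x}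
  fulldim : setDim {x : Fin n → ℝ | ∀ i, (b i : ℝ) ≤ ipair (A i) x} = n
  facet_dim : ∀ i, setDim {x : Fin n → ℝ |
      (∀ j, (b j : ℝ) ≤ ipair (A j) x) ∧ ipair (A i) x = (b i : ℝ)} + 1 = n
  irredundant : Function.Injective (fun i => (A i, b i))

namespace PolyDesc

variable {n m : ℕ} (D : PolyDesc n m)

/-- The polytope `P` itself. -/
def pts : Set (Fin n → ℝ) := {x | ∀ i, (D.b i : ℝ) ≤ ipair (D.A i) x}

/-- Lattice distance `d_{Fᵢ}(x) = ⟨aᵢ, x⟩ - bᵢ` from (the hyperplane spanned by)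
the `i`-th facet. -/
def dF (i : Fin m) (x : Fin n → ℝ) : ℝ := ipair (D.A i) x - (D.b i : ℝ)

/-- Lattice distance `d_P(x) = minᵢ d_{Fᵢ}(x)` from the boundary of `P`. -/
def dist (x : Fin n → ℝ) : ℝ :=
  Finset.univ.inf'
    (Finset.univ_nonempty_iff.mpr (Fin.pos_iff_nonempty.mp D.hm))
    (fun i => D.dF i x)

/-- The adjoint polytope `P⁽ˢ⁾ = {x : d_P(x) ≥ s}`. -/
def adj (s : ℝ) : Set (Fin n → ℝ) := {x | s ≤ D.dist x}

/-- The `i`-th facet `Fᵢ` of `P`. -/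
def facet (i : Fin m) : Set (Fin n → ℝ) := {x ∈ D.pts | ipair (D.A i) x = (D.b i : ℝ)}

/-- The set `{s > 0 : P⁽ˢ⁾ ≠ ∅}`, whose supremum is `μ(P)⁻¹`. -/
def qcdInvSet : Set ℝ := {s : ℝ | 0 < s ∧ (D.adj s).Nonempty}

/-- `μ(P)⁻¹ = sup {s > 0 : P⁽ˢ⁾ ≠ ∅}`. -/
def qcdInv : ℝ := sSup D.qcdInvSet

/-- The ℚ-codegree `μ(P) = (sup {s > 0 : P⁽ˢ⁾ ≠ ∅})⁻¹`. -/
def qcd : ℝ := D.qcdInv⁻¹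

/-- The core `core(P) = P^{(1/μ(P))}`. -/
def core : Set (Fin n → ℝ) := D.adj D.qcdInv

/-- The codegree `cd(P) = min {k ∈ ℕ, k ≥ 1 : int(kP) ∩ ℤⁿ ≠ ∅}`. -/
def codeg : ℕ := sInf {k : ℕ | 0 < k ∧
  ∃ z : Fin n → ℤ, (fun j => (z j : ℝ)) ∈ interior ((k : ℝ) • D.pts)}

end PolyDesc

/-- The face of `S` on which the linear functional `u` is maximized. -/
def argFace {n : ℕ} (S : Set (Fin n → ℝ)) (u : Fin n → ℝ) : Set (Fin n → ℝ) :=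
  {x ∈ S | ∀ y ∈ S, ∑ j, u j * y j ≤ ∑ j, u j * x j}

/-- `S` and `T` have the same normal fan: two linear functionals lie in the same
(relatively open) cone of the normal fan of `S`, i.e. are maximized on the same face
of `S`, iff the same holds for `T`. -/
def SameNormalFan {n : ℕ} (S T : Set (Fin n → ℝ)) : Prop :=
  ∀ u v : Fin n → ℝ, (argFace S u = argFace S v ↔ argFace T u = argFace T v)

/-- The normal fan of `S` refines the normal fan of `T`. -/
def RefinesNormalFan {n : ℕ} (S T : Set (Fin n → ℝ)) : Prop :=
  ∀ u v : Fin n → ℝ, argFace S u = argFace S v → argFace T u = argFace T v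

namespace PolyDesc
variable {n m : ℕ} (D : PolyDesc n m)

/-- `{s > 0 : N(P⁽ˢ⁾) = N(P)}`, whose supremum is `τ(P)⁻¹`. -/
def nefInvSet : Set ℝ := {s : ℝ | 0 < s ∧ SameNormalFan (D.adj s) D.pts}

/-- `τ(P)⁻¹ = sup {s > 0 : N(P⁽ˢ⁾) = N(P)}`. -/
def nefInv : ℝ := sSup D.nefInvSet

/-- The nef value `τ(P)`. -/
def nefVal : ℝ := D.nefInv⁻¹

/-- The set of inequalities active at `x`; the normal cone of the minimal face of `P`
containing `x` is generated by `{aᵢ : i ∈ active x}`, and all cones of the normal fan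
of `P` arise in this way. -/
def active (x : Fin n → ℝ) : Set (Fin m) := {i | ipair (D.A i) x = (D.b i : ℝ)}

/-- The normal cone at the vertex `v` is ℚ-Gorenstein of index `r`, witnessed by the
primitive lattice point `u = u_σ` with `⟨aᵢ, u⟩ = r` for all active `i`. -/
def VertexQG (v : Fin n → ℝ) (u : Fin n → ℤ) (r : ℤ) : Prop :=
  IsPrimitive u ∧ 0 < r ∧ ∀ i ∈ D.active v, (∑ j, D.A i j * u j) = r

/-- The normal fan of `P` is ℚ-Gorenstein: every maximal cone (normal cone of a
vertex, i.e. of an extreme point) is ℚ-Gorenstein. -/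
def QGorenstein : Prop := ∀ v ∈ Set.extremePoints ℝ D.pts, ∃ u r, D.VertexQG v u r

end PolyDesc

/-- The point `v(s) = v + (s/r_σ) • u_σ`. -/
def vmove {n : ℕ} (v : Fin n → ℝ) (s : ℝ) (u : Fin n → ℤ) (r : ℤ) : Fin n → ℝ :=
  v + (s / (r : ℝ)) • (fun j => ((u j : ℝ)))

/-- The height of a point `y` in the cone generated by `{aᵢ : i ∈ I}`:
`ht(y) = max {∑ λᵢ : λᵢ ≥ 0, ∑ λᵢ aᵢ = y}`. -/
def coneHeight {n m : ℕ} (D : PolyDesc n m) (I : Set (Fin m)) (y : Fin n → ℝ) : ℝ :=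
  sSup {t : ℝ | ∃ c : Fin m → ℝ, (∀ i, 0 ≤ c i) ∧ (∀ i ∉ I, c i = 0) ∧
    (y = ∑ i, c i • (fun j => ((D.A i j : ℝ)))) ∧ t = ∑ i, c i}

/-- `P` is α-canonical: for every cone `σ` of the normal fan of `P` (the normal cone
of the minimal face containing a point `x ∈ P`, generated by `{aᵢ : i ∈ active x}`),
every nonzero lattice point of `σ` has height at least `α`. -/
def AlphaCanonical {n m : ℕ} (D : PolyDesc n m) (α : ℝ) : Prop :=
  ∀ x ∈ D.pts, ∀ z : Fin n → ℤ, z ≠ 0 →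
    (∃ c : Fin m → ℝ, (∀ i, 0 ≤ c i) ∧ (∀ i ∉ D.active x, c i = 0) ∧
      ((fun j => ((z j : ℝ))) = ∑ i, c i • (fun j => ((D.A i j : ℝ))))) →
    α ≤ coneHeight D (D.active x) (fun j => ((z j : ℝ)))

/-- `P` is a lattice polytope: the convex hull of finitely many integer points. -/
def IsLatticePoly {n : ℕ} (P : Set (Fin n → ℝ)) : Prop :=
  ∃ V : Finset (Fin n → ℤ),
    P = convexHull ℝ ((fun z : Fin n → ℤ => fun j => ((z j : ℝ))) '' (V : Set (Fin n → ℤ)))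

/-- The `i`-th standard basis vector of `ℝᵗ`. -/
def stdBasisVec (t : ℕ) (i : Fin t) : Fin t → ℝ := fun j => if j = i then 1 else 0

/-- The marking vectors of a Cayley sum: `0, e₁, …, e_t ∈ ℝᵗ`. -/
def cayleyVec (t : ℕ) : Fin (t + 1) → (Fin t → ℝ) :=
  fun j => if h : (j : ℕ) = 0 then 0 else stdBasisVec t ⟨(j : ℕ) - 1, by have := j.isLt; omega⟩

/-- The Cayley sum `Q₀ * ⋯ * Q_t = conv((Q₀ × {0}) ∪ (Q₁ × {e₁}) ∪ ⋯ ∪ (Q_t × {e_t}))`. -/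
def cayleySum {k t : ℕ} (Q : Fin (t + 1) → Set (Fin k → ℝ)) :
    Set ((Fin k → ℝ) × (Fin t → ℝ)) :=
  convexHull ℝ (⋃ j, (Q j) ×ˢ ({cayleyVec t j} : Set (Fin t → ℝ)))

/-- `P ⊆ ℝⁿ` is a Cayley polytope `P₀ * ⋯ * P_t` of length `t+1` of lattice polytopes
`Pⱼ ⊆ ℝᵏ` with `k + t = n`: some affine lattice isomorphism `ℤⁿ ≅ ℤᵏ × ℤᵗ`
identifies `P` with such a Cayley sum. -/
def IsCayley {n : ℕ} (P : Set (Fin n → ℝ)) (k t : ℕ) : Prop :=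
  k + t = n ∧
  ∃ Q : Fin (t + 1) → Finset (Fin k → ℤ), (∀ j, (Q j).Nonempty) ∧
  ∃ f : (Fin n → ℝ) ≃ᵃ[ℝ] (Fin k → ℝ) × (Fin t → ℝ),
    f '' IntPts n = (IntPts k) ×ˢ (IntPts t) ∧
    f '' P = cayleySum (fun j =>
      convexHull ℝ ((fun z : Fin k → ℤ => fun i => ((z i : ℝ))) '' (Q j : Set (Fin k → ℤ))))

/-- The unimodular simplex `Δₙ = conv(0, e₁, …, eₙ)`. -/
def unimodSimplex (n : ℕ) : Set (Fin n → ℝ) :=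
  convexHull ℝ (insert (0 : Fin n → ℝ) (Set.range (stdBasisVec n)))

/-- Two subsets of `ℝⁿ` are unimodularly equivalent: an affine lattice automorphism
maps one onto the other. -/
def UnimodEquiv {n : ℕ} (P P' : Set (Fin n → ℝ)) : Prop :=
  ∃ f : (Fin n → ℝ) ≃ᵃ[ℝ] (Fin n → ℝ), f '' IntPts n = IntPts n ∧ f '' P = P'

/-- The codegree `cd(P) = min {k ∈ ℕ, k ≥ 1 : int(kP) ∩ ℤⁿ ≠ ∅}` of a polytope given
as a set. -/
def codegS {n : ℕ} (P : Set (Fin n → ℝ)) : ℕ :=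
  sInf {k : ℕ | 0 < k ∧ ∃ z : Fin n → ℤ, (fun j => (z j : ℝ)) ∈ interior ((k : ℝ) • P)}

/-- `P` has lattice width one: some nonzero integer linear functional has minimum `c`
and maximum `c + 1` on `P`. -/
def HasLatticeWidthOne {n : ℕ} (P : Set (Fin n → ℝ)) : Prop :=
  ∃ u : Fin n → ℤ, u ≠ 0 ∧ ∃ c : ℤ,
    (∀ x ∈ P, (c : ℝ) ≤ ipair u x ∧ ipair u x ≤ (c : ℝ) + 1) ∧
    (∃ x ∈ P, ipair u x = (c : ℝ)) ∧ (∃ x ∈ P, ipair u x = (c : ℝ) + 1)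

/-- `P` is a lattice pyramid: for some primitive `u`, `P` is the convex hull of a base
lying in the lattice hyperplane `{⟨u, ·⟩ = c}` and an apex at lattice distance one from
it (this is equivalent to being unimodularly equivalent to
`conv((Q × {0}) ∪ {(0, …, 0, 1)})` for an `(n-1)`-dimensional lattice polytope `Q`). -/
def IsLatticePyramid {n : ℕ} (P : Set (Fin n → ℝ)) : Prop :=
  ∃ u : Fin n → ℤ, IsPrimitive u ∧ ∃ c : ℤ, ∃ apex ∈ P,
    ipair u apex = (c : ℝ) + 1 ∧
    P = convexHull ℝ ({x ∈ P | ipair u x = (c : ℝ)} ∪ {apex})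

/-- `F` is a facet of `S`: an exposed face of dimension `dim S - 1`. -/
def IsFacetOf {n : ℕ} (F S : Set (Fin n → ℝ)) : Prop :=
  IsExposed ℝ S F ∧ F.Nonempty ∧ setDim F + 1 = setDim S

/-- The mountain `M(P) = {(x, s) : x ∈ P, 0 ≤ s ≤ d_P(x)} ⊆ ℝⁿ × ℝ`. -/
def mountain {n m : ℕ} (D : PolyDesc n m) : Set ((Fin n → ℝ) × ℝ) :=
  {p | p.1 ∈ D.pts ∧ 0 ≤ p.2 ∧ p.2 ≤ D.dist p.1}

/-! ### Polyhedra given by finitely many linear inequalities -/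

section Polyhedron

variable {ι E : Type*} [AddCommGroup E] [Module ℝ E]

/-- The polyhedron `{x : c i ≤ L i x for all i}`. -/
def polyhedron (L : ι → E →ₗ[ℝ] ℝ) (c : ι → ℝ) : Set E := {x | ∀ i, c i ≤ L i x}

variable {L : ι → E →ₗ[ℝ] ℝ} {c : ι → ℝ} {x : E}

lemma convex_polyhedron (L : ι → E →ₗ[ℝ] ℝ) (c : ι → ℝ) : Convex ℝ (polyhedron L c) := by
  intro x hx y hy a b ha hb hab i
  have h1 := mul_le_mul_of_nonneg_left (hx i) ha
  have h2 := mul_le_mul_of_nonneg_left (hy i) hb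
  simp only [map_add, map_smul, smul_eq_mul]
  calc c i = a * c i + b * c i := by rw [← add_mul, hab, one_mul]
    _ ≤ _ := add_le_add h1 h2

/-- If `d` does not decrease the active constraints at `x`, one can move from `x` a little in
direction `d` without leaving the polyhedron. -/
lemma exists_pos_add_smul_mem_polyhedron [Finite ι] (hx : x ∈ polyhedron L c) {d : E}
    (hd : ∀ i, L i x = c i → 0 ≤ L i d) : ∃ ε : ℝ, 0 < ε ∧ x + ε • d ∈ polyhedron L c := by
  have key : ∀ᶠ ε : ℝ in nhdsWithin 0 (Set.Ioi 0), ∀ i, c i ≤ L i (x + ε • d) := by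
    rw [Filter.eventually_all]
    intro i
    rcases (hx i).eq_or_lt with h | h
    · filter_upwards [self_mem_nhdsWithin] with ε hε
      simpa [h] using mul_nonneg (le_of_lt hε) (hd i h.symm)
    · have hc : Continuous fun ε : ℝ => L i (x + ε • d) := by
        simp only [map_add, map_smul, smul_eq_mul]
        fun_prop
      have : ∀ᶠ ε : ℝ in nhds 0, c i < L i (x + ε • d) :=
        (hc.tendsto 0).eventually_const_lt (by simpa using h)
      exact (this.filter_mono nhdsWithin_le_nhds).mono fun _ => le_of_lt
  obtain ⟨ε, h1, h2⟩ := (key.and self_mem_nhdsWithin).exists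
  exact ⟨ε, h2, h1⟩

lemma mem_extremePoints_polyhedron_iff [Finite ι] :
    x ∈ (polyhedron L c).extremePoints ℝ ↔
      x ∈ polyhedron L c ∧ ∀ d, (∀ i, L i x = c i → L i d = 0) → d = 0 := by
  constructor
  · intro hx
    refine ⟨hx.1, fun d hd => ?_⟩
    obtain ⟨ε, hε, h1⟩ := exists_pos_add_smul_mem_polyhedron hx.1 fun i hi => (hd i hi).ge
    obtain ⟨δ, hδ, h2⟩ := exists_pos_add_smul_mem_polyhedron (d := -d) hx.1
      fun i hi => by simp [hd i hi]
    have hmem : x ∈ openSegment ℝ (x + ε • d) (x + δ • -d) := by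
      refine ⟨δ / (ε + δ), ε / (ε + δ), by positivity, by positivity, by field_simp; ring, ?_⟩
      have h1 : δ / (ε + δ) + ε / (ε + δ) = 1 := by field_simp; ring
      have h2 : δ / (ε + δ) * ε - ε / (ε + δ) * δ = 0 := by ring
      calc _ = (δ / (ε + δ) + ε / (ε + δ)) • x +
            (δ / (ε + δ) * ε - ε / (ε + δ) * δ) • d := by module
        _ = x := by rw [h1, h2]; simp
    have := hx.2 h1 h2 hmem
    simpa [hε.ne'] using this
  · rintro ⟨hx, h⟩
    rw [mem_extremePoints_iff_left]
    refine ⟨hx, ?_⟩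
    rintro y hy z hz ⟨a, b, ha, hb, hab, rfl⟩
    have hyz : z - y = 0 := by
      refine h _ fun i hi => ?_
      simp only [map_add, map_smul, smul_eq_mul] at hi
      have h1 := hy i
      have h2 := hz i
      have e : a * (L i y - c i) + b * (L i z - c i) = 0 := by
        linear_combination hi - c i * hab
      have h3 : a * (L i y - c i) = 0 := by
        nlinarith [mul_nonneg ha.le (sub_nonneg.2 h1), mul_nonneg hb.le (sub_nonneg.2 h2)]
      have h4 : b * (L i z - c i) = 0 := by linarith
      have h5 : L i y - c i = 0 := (mul_eq_zero.1 h3).resolve_left ha.ne'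
      have h6 : L i z - c i = 0 := (mul_eq_zero.1 h4).resolve_left hb.ne'
      rw [map_sub]
      linarith
    rw [sub_eq_zero.1 hyz, ← add_smul, hab, one_smul]

/-- An extreme point of a polyhedron is determined by its set of active constraints. -/
lemma finite_extremePoints_polyhedron [Finite ι] (L : ι → E →ₗ[ℝ] ℝ) (c : ι → ℝ) :
    ((polyhedron L c).extremePoints ℝ).Finite := by
  refine Set.Finite.of_finite_image (f := fun x => {i | L i x = c i}) (Set.toFinite _) ?_
  intro x hx y _ hxy
  have := (mem_extremePoints_polyhedron_iff.1 hx).2 (y - x) fun i hi => by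
    have hi' : L i y = c i := (Set.ext_iff.1 hxy i).1 hi
    rw [map_sub, hi, hi', sub_self]
  exact (sub_eq_zero.1 this).symm

/-- Local criterion for a linear functional to be maximized over a polyhedron at `x`. -/
lemma forall_mem_polyhedron_le_iff [Finite ι] (hx : x ∈ polyhedron L c) (w : E →ₗ[ℝ] ℝ) :
    (∀ y ∈ polyhedron L c, w y ≤ w x) ↔ ∀ d, (∀ i, L i x = c i → 0 ≤ L i d) → w d ≤ 0 := by
  constructor
  · intro h d hd
    obtain ⟨ε, hε, hm⟩ := exists_pos_add_smul_mem_polyhedron hx hd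
    have := h _ hm
    simp only [map_add, map_smul, smul_eq_mul, add_le_iff_nonpos_right] at this
    exact nonpos_of_mul_nonpos_right this hε
  · intro h y hy
    have := h (y - x) fun i hi => by rw [map_sub, hi]; exact sub_nonneg.2 (hy i)
    rw [map_sub] at this
    linarith

/-- A nonzero functional is not maximized where all constraints are strict. -/
lemma eq_zero_of_forall_mem_polyhedron_le [Finite ι] (hx : ∀ i, c i < L i x) {w : E →ₗ[ℝ] ℝ}
    (hw : ∀ y ∈ polyhedron L c, w y ≤ w x) : w = 0 := by
  have h := (forall_mem_polyhedron_le_iff (fun i => (hx i).le) w).1 hw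
  ext d
  have h1 := h d fun i hi => absurd hi (hx i).ne'
  have h2 := h (-d) fun i hi => absurd hi (hx i).ne'
  rw [map_neg] at h2
  exact le_antisymm h1 (neg_nonpos.1 h2)

/-- If each constraint is strict somewhere on a convex part of a polyhedron, then all
constraints are simultaneously strict somewhere on it. -/
lemma exists_forall_lt_of_forall_exists_lt [Fintype ι] [Nonempty ι] {G : Set E}
    (hG : Convex ℝ G) (hGP : G ⊆ polyhedron L c) (h : ∀ i, ∃ g ∈ G, c i < L i g) :
    ∃ g ∈ G, ∀ i, c i < L i g := by
  choose g hg hlt using h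
  have hN : (0 : ℝ) < Fintype.card ι := by exact_mod_cast Fintype.card_pos
  refine ⟨∑ i, (Fintype.card ι : ℝ)⁻¹ • g i,
    hG.sum_mem (fun _ _ => by positivity) (by simp [hN.ne']) fun i _ => hg i, fun i => ?_⟩
  rw [map_sum]
  have e : c i = ∑ _k : ι, (Fintype.card ι : ℝ)⁻¹ * c i := by
    rw [Finset.sum_const, Finset.card_univ, nsmul_eq_mul]; field_simp
  rw [e]
  refine Finset.sum_lt_sum (fun k _ => ?_) ⟨i, Finset.mem_univ i, ?_⟩
  · rw [map_smul, smul_eq_mul]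
    exact mul_le_mul_of_nonneg_left (hGP (hg k) i) (by positivity)
  · rw [map_smul, smul_eq_mul]
    exact mul_lt_mul_of_pos_left (hlt i) (by positivity)

end Polyhedron

/-- A compact convex set with finitely many extreme points is their convex hull. -/
lemma IsCompact.convexHull_extremePoints {E : Type*} [NormedAddCommGroup E] [NormedSpace ℝ E]
    {S : Set E} (hS : IsCompact S) (hS' : Convex ℝ S) (hfin : (S.extremePoints ℝ).Finite) :
    convexHull ℝ (S.extremePoints ℝ) = S := by
  rw [← (hfin.isClosed_convexHull (𝕜 := ℝ)).closure_eq]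
  exact closure_convexHull_extremePoints hS hS'

/-! ### Faces and normal fans -/

section Faces

variable {n : ℕ} {S T : Set (Fin n → ℝ)} {u w : Fin n → ℝ}

/-- The linear functional `x ↦ ∑ uⱼ xⱼ`. -/
def dotL (u : Fin n → ℝ) : (Fin n → ℝ) →ₗ[ℝ] ℝ where
  toFun x := ∑ j, u j * x j
  map_add' x y := by simp [mul_add, Finset.sum_add_distrib]
  map_smul' r x := by
    simp only [Pi.smul_apply, smul_eq_mul, RingHom.id_apply, Finset.mul_sum]
    exact Finset.sum_congr rfl fun _ _ => by ring

lemma dotL_add (u w x : Fin n → ℝ) : dotL (u + w) x = dotL u x + dotL w x := by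
  simp [dotL, add_mul, Finset.sum_add_distrib]

lemma dotL_smul (t : ℝ) (u x : Fin n → ℝ) : dotL (t • u) x = t * dotL u x := by
  simp [dotL, mul_assoc, Finset.mul_sum]

lemma dotL_neg (u x : Fin n → ℝ) : dotL (-u) x = -dotL u x := by
  simp [dotL]

lemma dotL_single (u : Fin n → ℝ) (j : Fin n) : dotL u (Pi.single j 1) = u j := by
  simp [dotL, Pi.single_apply]

lemma eq_zero_of_dotL_eq_zero (h : dotL u = 0) : u = 0 :=
  funext fun j => by rw [← dotL_single u j, h]; rfl

lemma dotL_sum {ι : Type*} (s : Finset ι) (u : ι → Fin n → ℝ) (x : Fin n → ℝ) :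
    dotL (∑ i ∈ s, u i) x = ∑ i ∈ s, dotL (u i) x := by
  classical
  induction s using Finset.induction_on with
  | empty => simp [dotL]
  | insert i s hi ih => rw [Finset.sum_insert hi, Finset.sum_insert hi, dotL_add, ih]

lemma exists_dotL_eq (f : (Fin n → ℝ) →ₗ[ℝ] ℝ) : ∃ u, dotL u = f := by
  refine ⟨fun j => f (Pi.single j 1), LinearMap.pi_ext' fun j => LinearMap.ext_ring ?_⟩
  exact dotL_single _ j

lemma continuous_dotL (u : Fin n → ℝ) : Continuous (dotL u) :=
  (dotL u).continuous_of_finiteDimensional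

lemma mem_argFace {x : Fin n → ℝ} :
    x ∈ argFace S u ↔ x ∈ S ∧ ∀ y ∈ S, dotL u y ≤ dotL u x := Iff.rfl

lemma isExposed_argFace (S : Set (Fin n → ℝ)) (u : Fin n → ℝ) : IsExposed ℝ S (argFace S u) :=
  fun _ => ⟨LinearMap.toContinuousLinearMap (dotL u), rfl⟩

lemma argFace_nonempty (hS : IsCompact S) (hne : S.Nonempty) (u : Fin n → ℝ) :
    (argFace S u).Nonempty := by
  obtain ⟨x, hx, h⟩ := hS.exists_isMaxOn hne (continuous_dotL u).continuousOn
  exact ⟨x, hx, h⟩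

lemma exists_extremePoint_mem_argFace (hS : IsCompact S) (hne : S.Nonempty) (u : Fin n → ℝ) :
    ∃ v ∈ S.extremePoints ℝ, v ∈ argFace S u := by
  have hE := isExposed_argFace S u
  obtain ⟨v, hv⟩ := (hE.isCompact hS).extremePoints_nonempty (argFace_nonempty hS hne u)
  exact ⟨v, hE.isExtreme.extremePoints_subset_extremePoints hv, hv.1⟩

/-- A face is determined by its points in any finite set containing the extreme points. -/
lemma argFace_eq_convexHull {V : Set (Fin n → ℝ)} (hS : IsCompact S) (hS' : Convex ℝ S)
    (hV : V.Finite) (hSV : S.extremePoints ℝ ⊆ V) (u : Fin n → ℝ) :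
    argFace S u = convexHull ℝ (V ∩ argFace S u) := by
  have hE := isExposed_argFace S u
  have hc := hE.convex hS'
  refine (Set.Subset.antisymm ?_ (convexHull_min Set.inter_subset_right hc))
  have hsub : (argFace S u).extremePoints ℝ ⊆ V ∩ argFace S u := fun v hv =>
    ⟨hSV (hE.isExtreme.extremePoints_subset_extremePoints hv), hv.1⟩
  conv_lhs => rw [← (hE.isCompact hS).convexHull_extremePoints hc
    (hV.subset (hsub.trans Set.inter_subset_left))]
  exact convexHull_mono hsub

lemma argFace_eq_argFace_iff {V : Set (Fin n → ℝ)} (hS : IsCompact S) (hS' : Convex ℝ S)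
    (hV : V.Finite) (hSV : S.extremePoints ℝ ⊆ V) :
    argFace S u = argFace S w ↔ ∀ v ∈ V, v ∈ argFace S u ↔ v ∈ argFace S w := by
  refine ⟨fun h v _ => h ▸ Iff.rfl, fun h => ?_⟩
  rw [argFace_eq_convexHull hS hS' hV hSV u, argFace_eq_convexHull hS hS' hV hSV w]
  congr 1
  ext v
  exact and_congr_right (h v)

lemma argFace_add_smul (hne : (argFace S u).Nonempty) (h : argFace S u ⊆ argFace S w) {t : ℝ}
    (ht : 0 ≤ t) : argFace S (u + t • w) = argFace S u := by
  obtain ⟨x₀, hx₀⟩ := hne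
  ext x
  simp only [mem_argFace, dotL_add, dotL_smul]
  constructor
  · rintro ⟨hx, hmax⟩
    refine ⟨hx, fun y hy => (hx₀.2 y hy).trans ?_⟩
    have h1 := hmax x₀ hx₀.1
    have h2 := mul_le_mul_of_nonneg_left ((h hx₀).2 x hx) ht
    change dotL u x₀ ≤ _
    change t * dotL w x ≤ t * dotL w x₀ at h2
    linarith
  · rintro hx
    refine ⟨hx.1, fun y hy => add_le_add (hx.2 y hy) ?_⟩
    exact mul_le_mul_of_nonneg_left ((h hx).2 y hy) ht

/-- Sets with the same normal fan have the same inclusions between faces. -/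
lemma SameNormalFan.argFace_subset (hST : SameNormalFan S T) (hne : (argFace S u).Nonempty)
    (h : argFace S u ⊆ argFace S w) : argFace T u ⊆ argFace T w := by
  intro x hx
  refine ⟨hx.1, fun y hy => ?_⟩
  change dotL w y ≤ dotL w x
  by_contra! hlt
  have h0 : 0 < dotL w y - dotL w x := sub_pos.2 hlt
  have hu : dotL u y ≤ dotL u x := hx.2 y hy
  set t := (dotL u x - dotL u y) / (dotL w y - dotL w x) + 1 with ht
  have ht0 : 0 ≤ t := add_nonneg (div_nonneg (sub_nonneg.2 hu) h0.le) zero_le_one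
  have hm : x ∈ argFace T (u + t • w) := by
    rw [(hST _ _).1 (argFace_add_smul hne h ht0)]
    exact hx
  have := hm.2 y hy
  change dotL (u + t • w) y ≤ dotL (u + t • w) x at this
  simp only [dotL_add, dotL_smul] at this
  have e : t * (dotL w y - dotL w x) = dotL u x - dotL u y + (dotL w y - dotL w x) := by
    rw [ht, add_mul, div_mul_cancel₀ _ h0.ne', one_mul]
  linarith

lemma SameNormalFan.symm (hST : SameNormalFan S T) : SameNormalFan T S :=
  fun u v => (hST u v).symm

end Faces

/-! ### Facet normals -/

lemma exists_isCoprime_of_ne_zero {a : ℤ} (b : ℤ) (ha : a ≠ 0) :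
    ∃ p q g : ℤ, IsCoprime p q ∧ g ≠ 0 ∧ a = q * g ∧ b = p * g := by
  have hg : 0 < Int.gcd b a := Int.gcd_pos_of_ne_zero_right _ ha
  obtain ⟨p, q, hpq, hb, ha'⟩ := Int.exists_gcd_one hg
  exact ⟨p, q, _, Int.isCoprime_iff_gcd_eq_one.2 hpq, by exact_mod_cast hg.ne', ha', hb⟩

/-- Primitive integer vectors spanning the same ray are equal. -/
lemma IsPrimitive.eq_of_eq_smul {n : ℕ} {a b : Fin n → ℤ} (ha : IsPrimitive a)
    (hb : IsPrimitive b) {κ : ℝ} (hκ : 0 ≤ κ) (h : ∀ k, (b k : ℝ) = κ * a k) : b = a := by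
  obtain ⟨k₀, hk₀⟩ : ∃ k, a k ≠ 0 := Function.ne_iff.1 ha.1
  obtain ⟨p, q, g, hpq, hg, hag, hbg⟩ := exists_isCoprime_of_ne_zero (b k₀) hk₀
  have hcross : ∀ k, q * b k = p * a k := fun k => by
    have : a k₀ * b k = b k₀ * a k := by
      have : (a k₀ : ℝ) * b k = b k₀ * a k := by rw [h k, h k₀]; ring
      exact_mod_cast this
    rw [hag, hbg] at this
    exact mul_left_cancel₀ hg (by linear_combination this)
  have hqa : ∀ k, q ∣ a k := fun k => hpq.symm.dvd_of_dvd_mul_left ⟨b k, (hcross k).symm⟩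
  have hpb : ∀ k, p ∣ b k := fun k => hpq.dvd_of_dvd_mul_left ⟨a k, hcross k⟩
  choose c hc using hqa
  choose d hd using hpb
  have hq := Int.isUnit_iff.1 (ha.2 q c (funext hc))
  have hp := Int.isUnit_iff.1 (hb.2 p d (funext hd))
  have hne : b ≠ -a := by
    rintro rfl
    have h0 := h k₀
    have h1 : (a k₀ : ℝ) ≠ 0 := by exact_mod_cast hk₀
    simp only [Pi.neg_apply, Int.cast_neg] at h0
    rcases mul_eq_zero.1 (show (κ + 1) * (a k₀ : ℝ) = 0 by linarith) with h2 | h2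
    · linarith
    · exact h1 h2
  rcases hq with rfl | rfl <;> rcases hp with rfl | rfl
  · exact funext fun k => by linarith [hcross k]
  · exact absurd (funext fun k => by simpa using hcross k) hne
  · exact absurd (funext fun k => by simpa using congrArg Neg.neg (hcross k)) hne
  · exact funext fun k => by linarith [hcross k]

lemma vectorSpan_le_ker {E : Type*} [AddCommGroup E] [Module ℝ E] {S : Set E} {f : E →ₗ[ℝ] ℝ}
    {r : ℝ} (h : ∀ x ∈ S, f x = r) : vectorSpan ℝ S ≤ LinearMap.ker f := by
  refine Submodule.span_le.2 ?_
  rintro _ ⟨x, hx, y, hy, rfl⟩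
  simp [h x hx, h y hy]

namespace PolyDesc

variable {n m : ℕ} (D : PolyDesc n m)

/-- The `i`-th facet normal as a real vector. -/
def row (i : Fin m) : Fin n → ℝ := fun j => (D.A i j : ℝ)

/-- The facet normals as linear functionals. -/
def rowL (i : Fin m) : (Fin n → ℝ) →ₗ[ℝ] ℝ := dotL (D.row i)

lemma nonempty_index (D : PolyDesc n m) : Nonempty (Fin m) := Fin.pos_iff_nonempty.mp D.hm

lemma pts_eq : D.pts = polyhedron D.rowL (fun i => (D.b i : ℝ)) := rfl

lemma le_dist_iff {s : ℝ} {x : Fin n → ℝ} :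
    s ≤ D.dist x ↔ ∀ i, (D.b i : ℝ) + s ≤ D.rowL i x := by
  simp only [dist, Finset.le_inf'_iff, Finset.mem_univ, true_imp_iff, dF]
  refine forall_congr' fun i => ?_
  rw [le_sub_iff_add_le, add_comm]
  rfl

lemma adj_eq (s : ℝ) : D.adj s = polyhedron D.rowL (fun i => (D.b i : ℝ) + s) :=
  Set.ext fun _ => D.le_dist_iff

lemma adj_subset_pts {s : ℝ} (hs : 0 ≤ s) : D.adj s ⊆ D.pts := fun _ hx i =>
  (le_add_of_nonneg_right hs).trans (D.le_dist_iff.1 hx i)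

lemma isClosed_polyhedron_rowL (c : Fin m → ℝ) : IsClosed (polyhedron D.rowL c) := by
  have : polyhedron D.rowL c = ⋂ i, {x | c i ≤ D.rowL i x} := by
    ext x; simp [polyhedron]
  rw [this]
  exact isClosed_iInter fun i => isClosed_le continuous_const (continuous_dotL _)

lemma isCompact_pts : IsCompact D.pts :=
  Metric.isCompact_of_isClosed_isBounded (D.isClosed_polyhedron_rowL _) D.bounded

lemma isCompact_adj {s : ℝ} (hs : 0 ≤ s) : IsCompact (D.adj s) :=
  D.isCompact_pts.of_isClosed_subset (D.adj_eq s ▸ D.isClosed_polyhedron_rowL _)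
    (D.adj_subset_pts hs)

lemma convex_pts : Convex ℝ D.pts := convex_polyhedron D.rowL _

lemma convex_adj (s : ℝ) : Convex ℝ (D.adj s) := D.adj_eq s ▸ convex_polyhedron D.rowL _

lemma rowL_ne_zero (i : Fin m) : D.rowL i ≠ 0 := by
  intro h
  refine (D.prim i).1 (funext fun j => ?_)
  have := congrFun (eq_zero_of_dotL_eq_zero h) j
  simpa [row] using this

lemma exists_forall_lt : ∃ x, ∀ i, (D.b i : ℝ) < D.rowL i x := by
  have := D.nonempty_index
  obtain ⟨x, -, hx⟩ := exists_forall_lt_of_forall_exists_lt D.convex_pts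
    D.pts_eq.subset fun i => by
      by_contra! hi
      have hle := vectorSpan_le_ker (f := D.rowL i) (S := D.pts) (r := D.b i)
        fun x hx => le_antisymm (hi x hx) (hx i)
      have htop : vectorSpan ℝ D.pts = ⊤ := by
        refine Submodule.eq_top_of_finrank_eq ?_
        rw [Module.finrank_fin_fun]
        exact D.fulldim
      rw [htop, top_le_iff, LinearMap.ker_eq_top] at hle
      exact D.rowL_ne_zero i hle
  exact ⟨x, hx⟩

/-- If a facet lies in the face on which another facet functional is minimal, then the two
facet normals agree. -/
lemma A_eq_of_facet_subset {i j : Fin m} (hne : (D.facet i).Nonempty)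
    (h : D.facet i ⊆ argFace D.pts (-D.row j)) : D.A j = D.A i := by
  obtain ⟨f, hf⟩ := hne
  obtain ⟨x₀, hx₀⟩ := D.exists_forall_lt
  have hmin : ∀ x ∈ D.facet i, ∀ y ∈ D.pts, D.rowL j x ≤ D.rowL j y := fun x hx y hy => by
    have := (h hx).2 y hy
    change dotL (-D.row j) y ≤ dotL (-D.row j) x at this
    rw [dotL_neg, dotL_neg] at this
    exact neg_le_neg_iff.1 this
  have hker : vectorSpan ℝ (D.facet i) = LinearMap.ker (D.rowL i) := by
    refine Submodule.eq_of_le_of_finrank_eq (vectorSpan_le_ker fun x hx => hx.2) ?_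
    have h1 := (D.rowL i).finrank_range_add_finrank_ker
    rw [LinearMap.range_eq_top.2 (LinearMap.surjective (D.rowL_ne_zero i)), finrank_top,
      Module.finrank_self, Module.finrank_fin_fun] at h1
    have h2 : Module.finrank ℝ (vectorSpan ℝ (D.facet i)) + 1 = n := D.facet_dim i
    omega
  have hle : LinearMap.ker (D.rowL i) ≤ LinearMap.ker (D.rowL j) := hker ▸
    vectorSpan_le_ker fun x hx => le_antisymm (hmin x hx f hf.1) (hmin f hf x hx.1)
  have hi : 0 < D.rowL i (x₀ - f) := by
    rw [map_sub, sub_pos]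
    exact hf.2.trans_lt (hx₀ i)
  have hj : 0 ≤ D.rowL j (x₀ - f) := by
    rw [map_sub, sub_nonneg]
    exact hmin f hf x₀ fun k => (hx₀ k).le
  refine (D.prim i).eq_of_eq_smul (D.prim j) (div_nonneg hj hi.le) fun k => ?_
  have hz : Pi.single k 1 - (D.rowL i (Pi.single k 1) / D.rowL i (x₀ - f)) • (x₀ - f) ∈
      LinearMap.ker (D.rowL i) := by
    rw [LinearMap.mem_ker, map_sub, map_smul, smul_eq_mul, div_mul_cancel₀ _ hi.ne', sub_self]
  have := hle hz
  rw [LinearMap.mem_ker, map_sub, map_smul, smul_eq_mul, sub_eq_zero] at this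
  have ei : D.rowL i (Pi.single k 1) = D.A i k := dotL_single _ k
  have ej : D.rowL j (Pi.single k 1) = D.A j k := dotL_single _ k
  rw [ei, ej] at this
  rw [this]
  ring

lemma adj_nonempty_of_sameNormalFan {s : ℝ} (h : SameNormalFan (D.adj s) D.pts) :
    (D.adj s).Nonempty := by
  rw [Set.nonempty_iff_ne_empty]
  intro he
  obtain ⟨i⟩ := D.nonempty_index
  obtain ⟨x, hx⟩ := D.exists_forall_lt
  have h0 := (h (D.row i) 0).1 (by rw [he]; simp [argFace])
  have hm : x ∈ argFace D.pts (D.row i) := by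
    rw [h0]
    exact ⟨fun k => (hx k).le, fun y _ => by simp⟩
  exact D.rowL_ne_zero i (eq_zero_of_forall_mem_polyhedron_le hx hm.2)

lemma mem_argFace_neg_row_iff {S : Set (Fin n → ℝ)} {i : Fin m} {x : Fin n → ℝ} :
    x ∈ argFace S (-D.row i) ↔ x ∈ S ∧ ∀ y ∈ S, D.rowL i x ≤ D.rowL i y := by
  simp only [mem_argFace, dotL_neg, neg_le_neg_iff]
  rfl

lemma facet_eq_argFace {i : Fin m} (hne : (D.facet i).Nonempty) :
    D.facet i = argFace D.pts (-D.row i) := by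
  obtain ⟨f, hf⟩ := hne
  ext x
  rw [mem_argFace_neg_row_iff]
  refine ⟨fun hx => ⟨hx.1, fun y hy => hx.2.trans_le (hy i)⟩, fun hx => ⟨hx.1, ?_⟩⟩
  exact le_antisymm ((hx.2 f hf.1).trans_eq hf.2) (hx.1 i)

/-- If the normal fan of `P⁽ˢ⁾` is that of `P`, then every facet inequality remains tight. -/
lemma rowL_eq_of_sameNormalFan {s : ℝ} (hs : 0 ≤ s) (h : SameNormalFan (D.adj s) D.pts)
    {i : Fin m} (hne : (D.facet i).Nonempty) {q : Fin n → ℝ}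
    (hq : q ∈ argFace (D.adj s) (-D.row i)) : D.rowL i q = D.b i + s := by
  have := D.nonempty_index
  obtain ⟨j, hj⟩ : ∃ j, ∀ g ∈ argFace (D.adj s) (-D.row i), D.rowL j g ≤ D.b j + s := by
    by_contra! hcon
    obtain ⟨g, hg, hlt⟩ := exists_forall_lt_of_forall_exists_lt
      (L := D.rowL) (c := fun i => (D.b i : ℝ) + s)
      ((isExposed_argFace _ _).convex (D.convex_adj s))
      (fun x hx => D.adj_eq s ▸ hx.1) hcon
    have := eq_zero_of_forall_mem_polyhedron_le (w := dotL (-D.row i)) hlt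
      (D.adj_eq s ▸ hg.2)
    refine D.rowL_ne_zero i (LinearMap.ext fun x => ?_)
    have hx := dotL_neg (D.row i) x
    rw [this] at hx
    exact (neg_eq_zero.1 hx.symm)
  have hsub : argFace (D.adj s) (-D.row i) ⊆ argFace (D.adj s) (-D.row j) := fun g hg =>
    D.mem_argFace_neg_row_iff.2 ⟨hg.1, fun y hy => (hj g hg).trans (D.le_dist_iff.1 hy j)⟩
  have hA : D.A j = D.A i := by
    refine D.A_eq_of_facet_subset hne ?_
    rw [D.facet_eq_argFace hne]
    exact h.argFace_subset
      (argFace_nonempty (D.isCompact_adj hs) (D.adj_nonempty_of_sameNormalFan h) _) hsub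
  have hL : D.rowL j = D.rowL i := by
    unfold rowL row
    rw [hA]
  obtain ⟨f, hf⟩ := hne
  have hb : (D.b j : ℝ) ≤ D.b i :=
    calc (D.b j : ℝ) ≤ D.rowL j f := hf.1 j
      _ = D.b i := by rw [hL]; exact hf.2
  have h1 := hj q hq
  rw [hL] at h1
  exact le_antisymm (by linarith) (D.le_dist_iff.1 hq.1 i)

/-! ### The mountain -/

variable {D}

lemma mem_mountain {p : (Fin n → ℝ) × ℝ} :
    p ∈ mountain D ↔ 0 ≤ p.2 ∧ ∀ i, (D.b i : ℝ) + p.2 ≤ D.rowL i p.1 := by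
  rw [← D.le_dist_iff]
  exact ⟨fun h => h.2, fun h => ⟨D.adj_subset_pts h.1 h.2, h⟩⟩

variable (D)

/-- If `P⁽ˢ⁾` has the normal fan of `P`, then the mountain has no vertex at a height strictly
between `0` and `s`. -/
lemma not_mem_extremePoints_mountain {s h : ℝ} (hh : 0 < h) (hhs : h < s)
    (hN : SameNormalFan (D.adj s) D.pts) (x : Fin n → ℝ) :
    (x, h) ∉ (mountain D).extremePoints ℝ := by
  intro hx
  have hs : 0 < s := hh.trans hhs
  have hxm := (mem_mountain.1 hx.1).2
  set l := h / s with hl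
  have hl0 : 0 < l := div_pos hh hs
  have hl1 : 0 < 1 - l := sub_pos.2 ((div_lt_one hs).2 hhs)
  have hls : l * s = h := div_mul_cancel₀ _ hs.ne'
  obtain ⟨x₀, hx₀⟩ := D.exists_forall_lt
  have hpne : D.pts.Nonempty := ⟨x₀, fun i => (hx₀ i).le⟩
  have hK : x ∈ (1 - l) • D.pts + l • D.adj s := by
    by_contra hxK
    obtain ⟨f, r, hf, hfx⟩ := geometric_hahn_banach_closed_point
      ((D.convex_pts.smul (1 - l)).add ((D.convex_adj s).smul l))
      ((D.isCompact_pts.smul (1 - l)).add ((D.isCompact_adj hs.le).smul l)).isClosed hxK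
    obtain ⟨u, hu⟩ := exists_dotL_eq (f : (Fin n → ℝ) →ₗ[ℝ] ℝ)
    obtain ⟨v, hvu⟩ := argFace_nonempty D.isCompact_pts hpne u
    classical
    let U : Fin n → ℝ := ∑ i with D.rowL i v = D.b i, -D.row i
    have hsub : ∀ i, D.rowL i v = D.b i → argFace D.pts U ⊆ argFace D.pts (-D.row i) := by
      intro i hi z hz
      refine D.mem_argFace_neg_row_iff.2 ⟨hz.1, fun y hy => ?_⟩
      have h1 : dotL U v ≤ dotL U z := hz.2 v hvu.1
      simp only [U, dotL_sum, dotL_neg, Finset.sum_neg_distrib, neg_le_neg_iff] at h1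
      have h2 : ∀ k ∈ Finset.univ.filter fun i => D.rowL i v = D.b i,
          D.rowL k v ≤ D.rowL k z := fun k hk => (Finset.mem_filter.1 hk).2.trans_le (hz.1 k)
      have h3 := (Finset.sum_eq_sum_iff_of_le h2).1 (le_antisymm (Finset.sum_le_sum h2) h1) i
        (by simp [hi])
      rw [← h3, hi]
      exact hy i
    have hUne : (argFace D.pts U).Nonempty := argFace_nonempty D.isCompact_pts hpne U
    obtain ⟨q, hq⟩ := argFace_nonempty (D.isCompact_adj hs.le)
      (D.adj_nonempty_of_sameNormalFan hN) U
    have hqt : ∀ i, D.rowL i v = D.b i → D.rowL i q = D.b i + s := fun i hi =>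
      D.rowL_eq_of_sameNormalFan hs.le hN ⟨v, hvu.1, hi⟩
        (hN.symm.argFace_subset hUne (hsub i hi) hq)
    have hcrit := (forall_mem_polyhedron_le_iff (L := D.rowL) hvu.1 (dotL u)).1 hvu.2
      (x - ((1 - l) • v + l • q)) fun i hi => by
        simp only [map_sub, map_add, map_smul, smul_eq_mul, hi, hqt i hi]
        have := hxm i
        dsimp only at this
        linarith
    rw [map_sub, sub_nonpos, hu] at hcrit
    exact absurd hcrit (not_le.2 ((hf _ (Set.add_mem_add (Set.smul_mem_smul_set hvu.1)
      (Set.smul_mem_smul_set hq.1))).trans hfx))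
  obtain ⟨_, ⟨p, hp, rfl⟩, _, ⟨q, hq, rfl⟩, hpq⟩ := hK
  have hpm : (p, (0 : ℝ)) ∈ mountain D := mem_mountain.2 ⟨le_rfl, fun i => by
    rw [add_zero]; exact hp i⟩
  have hqm : (q, s) ∈ mountain D := mem_mountain.2 ⟨hs.le, D.le_dist_iff.1 hq⟩
  have := (mem_extremePoints_iff_left.1 hx).2 _ hpm _ hqm
    ⟨1 - l, l, hl1, hl0, by ring, Prod.ext hpq (by simpa using hls)⟩
  exact hh.ne (congrArg Prod.snd this)

/-- The constraints defining the mountain. -/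
def mountainL : Option (Fin m) → ((Fin n → ℝ) × ℝ) →ₗ[ℝ] ℝ
  | none => LinearMap.snd ℝ _ _
  | some i => D.rowL i ∘ₗ LinearMap.fst ℝ _ _ - LinearMap.snd ℝ _ _

/-- The right hand sides of the constraints defining the mountain. -/
def mountainC : Option (Fin m) → ℝ
  | none => 0
  | some i => D.b i

lemma mountain_eq : mountain D = polyhedron D.mountainL D.mountainC := by
  ext p
  rw [mem_mountain]
  simp only [polyhedron, Set.mem_ofPred_eq, Option.forall, mountainL, mountainC]
  exact and_congr_right fun _ => forall_congr' fun i => le_sub_iff_add_le.symm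

lemma convex_mountain : Convex ℝ (mountain D) := D.mountain_eq ▸ convex_polyhedron _ _

lemma finite_extremePoints_mountain : ((mountain D).extremePoints ℝ).Finite :=
  D.mountain_eq ▸ finite_extremePoints_polyhedron _ _

lemma isCompact_mountain : IsCompact (mountain D) := by
  obtain ⟨i⟩ := D.nonempty_index
  obtain ⟨B, hB⟩ := D.isCompact_pts.bddAbove_image (continuous_dotL (D.row i)).continuousOn
  refine (D.isCompact_pts.prod (isCompact_Icc (a := 0) (b := B - D.b i))).of_isClosed_subset ?_ ?_
  · have : mountain D = ⋂ k, {p | D.mountainC k ≤ D.mountainL k p} := by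
      rw [mountain_eq]
      ext p
      simp [polyhedron]
    rw [this]
    exact isClosed_iInter fun k =>
      isClosed_le continuous_const (D.mountainL k).continuous_of_finiteDimensional
  · intro p hp
    refine ⟨hp.1, hp.2.1, ?_⟩
    have h1 := (mem_mountain.1 hp).2 i
    have h2 : D.rowL i p.1 ≤ B := hB ⟨p.1, hp.1, rfl⟩
    linarith

/-- The vertices of the mountain are rational: a `ℚ`-linear retraction `ℝ → ℚ` applied to the
coordinates of a vertex preserves its active constraints. -/
lemma exists_rat_of_mem_extremePoints_mountain {p : (Fin n → ℝ) × ℝ}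
    (hp : p ∈ (mountain D).extremePoints ℝ) :
    ∃ v : (Fin n → ℚ) × ℚ, ((fun j => ((v.1 j : ℝ))), (v.2 : ℝ)) = p := by
  obtain ⟨f, hf⟩ := LinearMap.exists_leftInverse_of_injective (Algebra.linearMap ℚ ℝ)
    (LinearMap.ker_eq_bot.2 (algebraMap ℚ ℝ).injective)
  have hf' : ∀ q : ℚ, f q = q := fun q => LinearMap.congr_fun hf q
  have hfz : ∀ (z : ℤ) (t : ℝ), f (z * t) = z * f t := fun z t => by
    rw [← zsmul_eq_mul, map_zsmul, zsmul_eq_mul]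
  rw [mountain_eq] at hp
  refine ⟨(fun j => f (p.1 j), f p.2), sub_eq_zero.1 ?_⟩
  refine (mem_extremePoints_polyhedron_iff.1 hp).2 _ fun k hk => ?_
  rw [map_sub, sub_eq_zero, hk]
  cases k with
  | none =>
    have h0 : p.2 = 0 := hk
    change ((f p.2 : ℚ) : ℝ) = 0
    rw [h0, map_zero, Rat.cast_zero]
  | some i =>
    have h0 : ∑ j, (D.A i j : ℝ) * p.1 j - p.2 = (D.b i : ℝ) := hk
    change ∑ j, (D.A i j : ℝ) * ((f (p.1 j) : ℚ) : ℝ) - ((f p.2 : ℚ) : ℝ) = (D.b i : ℝ)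
    have h1 := congrArg f h0
    rw [map_sub, map_sum, hf'] at h1
    simp only [hfz] at h1
    exact_mod_cast h1

lemma isGreatest_qcdInv :
    IsGreatest {s : ℝ | ∃ x, (x, s) ∈ (mountain D).extremePoints ℝ} D.qcdInv ∧ 0 < D.qcdInv := by
  have := D.nonempty_index
  obtain ⟨x₀, hx₀⟩ := D.exists_forall_lt
  have hpos : 0 < D.dist x₀ := by
    simp only [dist, Finset.lt_inf'_iff, Finset.mem_univ, true_imp_iff]
    exact fun i => sub_pos.2 (hx₀ i)
  have hm₀ : (x₀, D.dist x₀) ∈ mountain D := ⟨fun i => (hx₀ i).le, hpos.le, le_rfl⟩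
  let f : ((Fin n → ℝ) × ℝ) →L[ℝ] ℝ := ContinuousLinearMap.snd ℝ _ _
  have hE : IsExposed ℝ (mountain D) (f.toExposed (mountain D)) := ContinuousLinearMap.toExposed.isExposed
  have hne : (f.toExposed (mountain D)).Nonempty := by
    obtain ⟨p, hp, h⟩ := D.isCompact_mountain.exists_isMaxOn ⟨_, hm₀⟩ f.continuous.continuousOn
    exact ⟨p, hp, h⟩
  obtain ⟨⟨x, s⟩, hxs⟩ := (hE.isCompact D.isCompact_mountain).extremePoints_nonempty hne
  have hext := hE.isExtreme.extremePoints_subset_extremePoints hxs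
  have hmax : ∀ p ∈ mountain D, p.2 ≤ s := hxs.1.2
  have hs : 0 < s := hpos.trans_le (hmax _ hm₀)
  have hq : IsGreatest D.qcdInvSet s :=
    ⟨⟨hs, x, hext.1.2.2⟩, fun t ⟨ht, y, hy⟩ =>
      hmax (y, t) (mem_mountain.2 ⟨ht.le, D.le_dist_iff.1 hy⟩)⟩
  have hqs : D.qcdInv = s := hq.csSup_eq
  rw [hqs]
  exact ⟨⟨⟨x, hext⟩, fun t ⟨y, hy⟩ => hmax _ hy.1⟩, hs⟩

/-- The vertex `v` of a `ℚ`-Gorenstein polytope moves along `u_σ / r_σ` up to a vertex of the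
mountain; strictly below the lowest positive height `h` of a vertex of the mountain, the active
constraints do not change. -/
lemma exists_moved_vertex {h : ℝ}
    (hmin : ∀ x t, 0 < t → (x, t) ∈ (mountain D).extremePoints ℝ → h ≤ t)
    {v : Fin n → ℝ} (hv : v ∈ D.pts.extremePoints ℝ) {u : Fin n → ℤ} {r : ℤ}
    (hu : D.VertexQG v u r) {s : ℝ} (hs : 0 ≤ s) (hsh : s < h) :
    ∃ y ∈ D.adj s, ∀ i, D.rowL i y = D.b i + s ↔ D.rowL i v = D.b i := by
  obtain ⟨-, hr, hact⟩ := hu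
  have hr' : (0 : ℝ) < r := by exact_mod_cast hr
  let w : Fin n → ℝ := (r : ℝ)⁻¹ • fun j => (u j : ℝ)
  have hw : ∀ i, D.rowL i v = D.b i → D.rowL i w = 1 := fun i hi => by
    have h1 : D.rowL i (fun j => (u j : ℝ)) = r := by
      rw [← hact i hi]
      push_cast
      rfl
    rw [map_smul, h1, smul_eq_mul, inv_mul_cancel₀ hr'.ne']
  let p : ℝ → (Fin n → ℝ) × ℝ := fun t => (v + t • w, t)
  have hp : Continuous p := by fun_prop
  have hpadd : ∀ t ε, p t + ε • (w, 1) = p (t + ε) := fun t ε => by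
    simp [p, add_smul, add_assoc]
  have hp0 : p 0 ∈ mountain D := mem_mountain.2 ⟨le_rfl, fun i => by
    change D.b i + 0 ≤ D.rowL i (v + (0 : ℝ) • w)
    rw [zero_smul, add_zero, add_zero]
    exact hv.1 i⟩
  have hT : IsCompact (p ⁻¹' mountain D) :=
    (D.isCompact_mountain.image continuous_snd).of_isClosed_subset
      (D.isCompact_mountain.isClosed.preimage hp) fun t ht => ⟨_, ht, rfl⟩
  obtain ⟨t, ht, hmax⟩ := hT.exists_isMaxOn ⟨0, hp0⟩ continuousOn_id
  have hmax : ∀ t', p t' ∈ mountain D → t' ≤ t := hmax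
  have ht0 : 0 < t := by
    have hp0' := D.mountain_eq ▸ hp0
    obtain ⟨ε, hε, hm⟩ := exists_pos_add_smul_mem_polyhedron hp0' (d := (w, 1)) fun k hk => by
      cases k with
      | none => exact zero_le_one
      | some i =>
        have : D.rowL i v = D.b i := by simpa [p, mountainL, mountainC] using hk
        simp [mountainL, hw i this]
    rw [hpadd, zero_add, ← mountain_eq] at hm
    exact hε.trans_le (hmax ε hm)
  have hactive : ∀ i, D.rowL i v = D.b i → ∀ t, D.rowL i (v + t • w) = D.b i + t :=
    fun i hi t => by rw [map_add, map_smul, hw i hi, hi, smul_eq_mul, mul_one]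
  have htm := mem_mountain.1 ht
  have hext : p t ∈ (mountain D).extremePoints ℝ := by
    have ht' := D.mountain_eq ▸ ht
    rw [mountain_eq]
    refine mem_extremePoints_polyhedron_iff.2 ⟨ht', fun d hd => ?_⟩
    have hd1 : d.1 - d.2 • w = 0 := by
      refine (mem_extremePoints_polyhedron_iff.1 (D.pts_eq ▸ hv)).2 _ fun i hi => ?_
      have : D.rowL i d.1 - d.2 = 0 := hd (some i) (sub_eq_of_eq_add (hactive i hi t))
      rw [map_sub, map_smul, hw i hi, smul_eq_mul, mul_one, this]
    have hdw : d = d.2 • (w, 1) := Prod.ext (by simpa using sub_eq_zero.1 hd1) (by simp)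
    by_contra hd0
    have hd2 : d.2 ≠ 0 := fun h0 => hd0 (by rw [hdw, h0, zero_smul])
    obtain ⟨ε, hε, hm⟩ := exists_pos_add_smul_mem_polyhedron ht' (d := (w, 1)) fun k hk => by
      have := hd k hk
      rw [hdw, map_smul, smul_eq_mul] at this
      exact ((mul_eq_zero.1 this).resolve_left hd2).ge
    rw [hpadd, ← mountain_eq] at hm
    linarith [hmax _ hm]
  have hst : s < t := hsh.trans_le (hmin _ _ ht0 hext)
  have hinactive : ∀ i, D.rowL i v ≠ D.b i → D.b i + s < D.rowL i (v + s • w) := fun i hi => by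
    have h0 : (D.b i : ℝ) < D.rowL i v := lt_of_le_of_ne (hv.1 i) (Ne.symm hi)
    have h1 : D.b i + t ≤ D.rowL i (v + t • w) := htm.2 i
    rw [map_add, map_smul, smul_eq_mul] at h1 ⊢
    have h2 : 0 < (t - s) * (D.rowL i v - D.b i) := mul_pos (sub_pos.2 hst) (sub_pos.2 h0)
    have h3 : 0 ≤ s * (D.rowL i v + t * D.rowL i w - (D.b i + t)) :=
      mul_nonneg hs (sub_nonneg.2 h1)
    have h4 : 0 < t * (D.rowL i v + s * D.rowL i w - (D.b i + s)) := by linarith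
    linarith [pos_of_mul_pos_right h4 ht0.le]
  have hiff : ∀ i, D.rowL i (v + s • w) = D.b i + s ↔ D.rowL i v = D.b i := fun i =>
    ⟨fun h1 => by_contra fun h2 => (hinactive i h2).ne' h1, fun h1 => hactive i h1 s⟩
  refine ⟨v + s • w, D.le_dist_iff.2 fun i => ?_, hiff⟩
  by_cases hi : D.rowL i v = D.b i
  · exact (hactive i hi s).ge
  · exact (hinactive i hi).le

/-- If every vertex of `P` moves to a point of `P⁽ˢ⁾` with the same active constraints, then
`P⁽ˢ⁾` and `P` have the same normal fan. -/
lemma sameNormalFan_of_moved_vertices {s : ℝ} (hs : 0 ≤ s)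
    (h : ∀ v ∈ D.pts.extremePoints ℝ,
      ∃ y ∈ D.adj s, ∀ i, D.rowL i y = D.b i + s ↔ D.rowL i v = D.b i) :
    SameNormalFan (D.adj s) D.pts := by
  choose! φ hφ hφ' using h
  set V := D.pts.extremePoints ℝ with hV
  have hVfin : V.Finite := finite_extremePoints_polyhedron D.rowL _
  obtain ⟨x₀, hx₀⟩ := D.exists_forall_lt
  have hpne : D.pts.Nonempty := ⟨x₀, fun i => (hx₀ i).le⟩
  have hiff : ∀ v ∈ V, ∀ u, φ v ∈ argFace (D.adj s) u ↔ v ∈ argFace D.pts u := by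
    intro v hv u
    have h1 := forall_mem_polyhedron_le_iff (L := D.rowL) (D.adj_eq s ▸ hφ v hv) (dotL u)
    have h2 := forall_mem_polyhedron_le_iff (L := D.rowL) hv.1 (dotL u)
    rw [mem_argFace, mem_argFace, and_iff_right (hφ v hv), and_iff_right hv.1]
    rw [← D.adj_eq] at h1
    refine h1.trans (Iff.trans ?_ h2.symm)
    simp only [hφ' v hv]
  have hφfin : (φ '' V).Finite := hVfin.image φ
  have hconv : D.adj s = convexHull ℝ (φ '' V) := by
    refine Set.Subset.antisymm (fun x hx => ?_)
      (convexHull_min (Set.image_subset_iff.2 hφ) (D.convex_adj s))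
    by_contra hxK
    obtain ⟨f, r, hf, hfx⟩ := geometric_hahn_banach_closed_point
      (convex_convexHull ℝ (φ '' V)) (hφfin.isClosed_convexHull ℝ) hxK
    obtain ⟨u, hu⟩ := exists_dotL_eq (f : (Fin n → ℝ) →ₗ[ℝ] ℝ)
    obtain ⟨v, hv, hvu⟩ := exists_extremePoint_mem_argFace D.isCompact_pts hpne u
    have h1 := (mem_argFace.1 ((hiff v hv u).2 hvu)).2 x hx
    rw [hu] at h1
    exact absurd h1 (not_le.2
      ((hf _ (subset_convexHull ℝ _ (Set.mem_image_of_mem φ hv))).trans hfx))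
  have hsub : (D.adj s).extremePoints ℝ ⊆ φ '' V := by
    rw [hconv]
    exact extremePoints_convexHull_subset
  intro u w
  rw [argFace_eq_argFace_iff (D.isCompact_adj hs) (D.convex_adj s) hφfin hsub,
    argFace_eq_argFace_iff D.isCompact_pts D.convex_pts hVfin subset_rfl, Set.forall_mem_image]
  exact forall₂_congr fun v hv => by rw [hiff v hv, hiff v hv]

lemma isLeast_nefInv (hQ : D.QGorenstein) :
    IsLeast {s : ℝ | 0 < s ∧ ∃ x, (x, s) ∈ (mountain D).extremePoints ℝ} D.nefInv := by
  set H := {s : ℝ | 0 < s ∧ ∃ x, (x, s) ∈ (mountain D).extremePoints ℝ} with hH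
  have hfin : H.Finite := (D.finite_extremePoints_mountain.image Prod.snd).subset
    fun s ⟨_, x, hx⟩ => ⟨(x, s), hx, rfl⟩
  have hne : H.Nonempty := ⟨D.qcdInv, D.isGreatest_qcdInv.2, D.isGreatest_qcdInv.1.1⟩
  obtain ⟨h, hh, hmin⟩ := Set.exists_min_image H id hfin hne
  have hmem : ∀ s, 0 < s → s < h → s ∈ D.nefInvSet := fun s hs hsh =>
    ⟨hs, D.sameNormalFan_of_moved_vertices hs.le fun v hv => by
      obtain ⟨u, r, hu⟩ := hQ v hv
      exact D.exists_moved_vertex (fun x t ht hx => hmin t ⟨ht, x, hx⟩) hv hu hs.le hsh⟩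
  have hlub : IsLUB D.nefInvSet h := by
    refine ⟨fun s hs => ?_, fun b hb => ?_⟩
    · by_contra! hlt
      obtain ⟨h0, x, hx⟩ := hh
      exact D.not_mem_extremePoints_mountain h0 hlt hs.2 x hx
    · refine le_of_forall_lt fun s hs => ?_
      obtain ⟨t, ht, hth⟩ := exists_between (max_lt hs hh.1)
      exact (lt_of_le_of_lt (le_max_left _ _) ht).trans_le
        (hb (hmem t (lt_of_le_of_lt (le_max_right _ _) ht) hth))
  have hnef : D.nefInv = h :=
    hlub.csSup_eq ⟨h / 2, hmem _ (half_pos hh.1) (half_lt_self hh.1)⟩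
  rw [hnef]
  exact ⟨hh, fun s hs => hmin s hs⟩

end PolyDesc

/-- The mountain satisfies
`M(P) = {(x, s) : ⟨aᵢ, x⟩ - s ≥ bᵢ for all i, s ≥ 0}`; hence it is a rational
polytope, whose horizontal slice at height `s₀ ≥ 0` is `P⁽ˢ⁰⁾ × {s₀}`. Moreover
`μ(P)⁻¹` is the maximum of the last coordinates of the vertices of `M(P)`, and if
`N(P)` is ℚ-Gorenstein then `τ(P)⁻¹` is the minimum of the positive last coordinates
of the vertices of `M(P)`. -/
theorem statement6 {n m : ℕ} (D : PolyDesc n m) :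
    mountain D = {p : (Fin n → ℝ) × ℝ |
      (∀ i, (D.b i : ℝ) ≤ ipair (D.A i) p.1 - p.2) ∧ 0 ≤ p.2} ∧
    (∃ V : Finset ((Fin n → ℚ) × ℚ), mountain D = convexHull ℝ
      ((fun v : (Fin n → ℚ) × ℚ => ((fun j => ((v.1 j : ℝ))), (v.2 : ℝ))) ''
        (V : Set ((Fin n → ℚ) × ℚ)))) ∧
    (∀ s₀ : ℝ, 0 ≤ s₀ → {x : Fin n → ℝ | (x, s₀) ∈ mountain D} = D.adj s₀) ∧
    IsGreatest {s : ℝ | ∃ x, (x, s) ∈ Set.extremePoints ℝ (mountain D)} D.qcdInv ∧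
    (D.QGorenstein →
      IsLeast {s : ℝ | 0 < s ∧ ∃ x, (x, s) ∈ Set.extremePoints ℝ (mountain D)}
        D.nefInv) := by
  refine ⟨?_, ?_, ?_, D.isGreatest_qcdInv.1, D.isLeast_nefInv⟩
  · ext p
    rw [PolyDesc.mem_mountain, and_comm]
    exact and_congr_left fun _ => forall_congr' fun i => le_sub_iff_add_le.symm
  · have hfin := D.finite_extremePoints_mountain
    choose! ρ hρ using fun p => D.exists_rat_of_mem_extremePoints_mountain (p := p)
    refine ⟨(hfin.image ρ).toFinset, ?_⟩
    rw [Set.Finite.coe_toFinset, Set.image_image, Set.image_congr hρ, Set.image_id',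
      D.isCompact_mountain.convexHull_extremePoints D.convex_mountain hfin]
  · intro s hs
    ext x
    exact ⟨fun h => h.2.2, fun h => ⟨D.adj_subset_pts hs h, hs, h⟩⟩

end
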